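/- arXiv:1612.07822 — 3 statements merged into one kernel-verified Lean document; each statement's English description precedes it below -/
import Mathlib

section
/- Let X be a finite set of cardinality n and let G be an abelian transitive subgroup of Perm X. If σ is a non-identity element of G of order a, then a divides n and σ is a product of exactly n/a disjoint cycles each of length a; equivalently, the cycle type of σ is the multiset consisting of n/a copies of a. -/
/-- An element of the centralizer of a transitive set of permutations that has a fixed point
is the identity. -/
theorem Equiv.Perm.eq_one_of_commute_of_transitive {X : Type*} {S : Set (Equiv.Perm X)}
    (htrans : ∀ x y : X, ∃ g ∈ S, g x = y) {τ : Equiv.Perm X}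
    (hτ : ∀ g ∈ S, Commute τ g) {x : X} (hx : τ x = x) : τ = 1 := by
  ext y
  obtain ⟨g, hg, rfl⟩ := htrans x y
  rw [← Equiv.Perm.mul_apply, (hτ g hg).eq, Equiv.Perm.mul_apply, hx, Equiv.Perm.one_apply]

/-- If no nontrivial power of `σ` has a fixed point, every cycle of `σ` has length
`orderOf σ`. -/
theorem Equiv.Perm.eq_orderOf_of_mem_cycleType {X : Type*} [Fintype X] [DecidableEq X]
    {σ : Equiv.Perm X} (hfree : ∀ (k : ℕ) (x : X), (σ ^ k) x = x → σ ^ k = 1) {m : ℕ}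
    (hm : m ∈ σ.cycleType) : m = orderOf σ := by
  refine Nat.dvd_antisymm (Equiv.Perm.dvd_of_mem_cycleType hm) (orderOf_dvd_of_pow_eq_one ?_)
  obtain ⟨c, τ, rfl, hd, hc, rfl⟩ := Equiv.Perm.mem_cycleType_iff.mp hm
  obtain ⟨x, hx, -⟩ := id hc
  apply hfree _ x
  rw [hd.commute.mul_pow, ← hc.orderOf, pow_orderOf_eq_one, one_mul]
  exact Equiv.Perm.pow_apply_eq_self_of_apply_eq_self ((hd x).resolve_left hx) _

/-- If `σ` is a non-identity element of order `a` of an abelian transitive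
subgroup of `Perm X` with `|X| = n`, then `a ∣ n` and `σ` is a product of exactly `n / a`
disjoint cycles each of length `a`, i.e. its cycle type is `n / a` copies of `a`. -/
theorem cycleType_of_element_of_abelian_transitive
    {X : Type*} [Fintype X] [DecidableEq X] (n a : ℕ) (hn : Fintype.card X = n)
    (G : Subgroup (Equiv.Perm X))
    (hab : ∀ x ∈ G, ∀ y ∈ G, x * y = y * x)
    (htrans : ∀ x y : X, ∃ g ∈ G, g x = y)
    (σ : Equiv.Perm X) (hσG : σ ∈ G) (hσ : σ ≠ 1) (ha : orderOf σ = a) :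
    a ∣ n ∧ σ.cycleType = Multiset.replicate (n / a) a := by
  subst hn ha
  have hfree (k : ℕ) (x : X) (hx : (σ ^ k) x = x) : σ ^ k = 1 :=
    Equiv.Perm.eq_one_of_commute_of_transitive (S := G) htrans
      (fun g hg ↦ hab _ (G.pow_mem hσG k) g hg) hx
  have hrep : σ.cycleType = Multiset.replicate σ.cycleType.card (orderOf σ) :=
    Multiset.eq_replicate_card.mpr fun _ ↦ Equiv.Perm.eq_orderOf_of_mem_cycleType hfree
  have hsupp : σ.support = Finset.univ := by
    refine Finset.eq_univ_of_forall fun x ↦ Equiv.Perm.mem_support.mpr fun hx ↦ hσ ?_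
    simpa using hfree 1 x (by simpa using hx)
  have hcard : Fintype.card X = σ.cycleType.card * orderOf σ := by
    rw [← Finset.card_univ, ← hsupp, ← Equiv.Perm.sum_cycleType, hrep]
    simp
  refine ⟨Dvd.intro_left _ hcard.symm, ?_⟩
  rwa [hcard, Nat.mul_div_cancel _ (orderOf_pos σ)]
end

section
/- Let a₁, a₂, δ, μ be positive integers with a₁ ≥ 2, a₂ ≥ 2, such that δ divides a₂, μ divides a₁, and 2δ + (a₁ − 1)(a₂ − 1) − 1 = δμ. Then a₂ ≤ δ + 1, and consequently either a₂ = δ, or δ = 1 and a₂ = 2. -/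
/-- If `a₁, a₂ ≥ 2`, `δ ∣ a₂`, `μ ∣ a₁` (all positive integers) and
`2δ + (a₁ − 1)(a₂ − 1) − 1 = δμ`, then `a₂ ≤ δ + 1`, and consequently either `a₂ = δ`,
or `δ = 1` and `a₂ = 2`. -/
theorem genus_zero_arithmetic_condition
    (a₁ a₂ δ μ : ℤ) (ha₁ : 2 ≤ a₁) (ha₂ : 2 ≤ a₂) (hδ : 0 < δ) (hμ : 0 < μ)
    (hδa : δ ∣ a₂) (hμa : μ ∣ a₁)
    (heq : 2 * δ + (a₁ - 1) * (a₂ - 1) - 1 = δ * μ) :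
    a₂ ≤ δ + 1 ∧ (a₂ = δ ∨ (δ = 1 ∧ a₂ = 2)) := by
  have hμ_le : μ ≤ a₁ := Int.le_of_dvd (by linarith) hμa
  have h_le : a₂ ≤ δ + 1 := by
    by_contra! h
    nlinarith [mul_le_mul_of_nonneg_left hμ_le hδ.le,
      mul_nonneg (sub_nonneg.2 ha₁) (by linarith : 0 ≤ a₂ - 1 - δ)]
  refine ⟨h_le, ?_⟩
  obtain ⟨k, rfl⟩ := hδa
  have hk : 0 < k := pos_of_mul_pos_right (by linarith) hδ.le
  rcases (Int.add_one_le_of_lt hk).eq_or_lt with h | h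
  · left
    rw [← h]
    ring
  · right
    have hδ_eq : δ = 1 := by nlinarith
    subst hδ_eq
    exact ⟨rfl, by linarith⟩
end

section
/- For every integer α ≥ 2 there exist permutations σ₁ and σ₂ of a set with 2α elements such that: σ₁ and σ₂ are each a product of two disjoint α-cycles (in particular each has order α); the subgroup generated by σ₁ and σ₂ acts transitively on the 2α points; and the product σ₁σ₂ is a product of exactly two disjoint transpositions, so it has order 2 and exactly 2α − 4 fixed points. -/
open Equiv Equiv.Perm

/-- If the cycle type of `σ` has two entries, adding up to the number of points, then `σ` has
exactly two orbits. -/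
theorem Equiv.Perm.exists_two_orbits {X : Type*} [Fintype X] [DecidableEq X] {σ : Perm X}
    (hcard : Multiset.card σ.cycleType = 2) (hsum : σ.cycleType.sum = Fintype.card X) :
    ∃ a b, ¬ σ.SameCycle a b ∧ (∀ x, σ.SameCycle a x ∨ σ.SameCycle b x) ∧ ∀ x, σ x ≠ x := by
  have hsupp : σ.support = Finset.univ := by
    rw [← Finset.card_eq_iff_eq_univ, ← sum_cycleType, hsum]
  have hmem (x : X) : x ∈ σ.support := hsupp ▸ Finset.mem_univ x
  have hfac : σ.cycleFactorsFinset.card = 2 := by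
    simpa [cycleType_def] using hcard
  obtain ⟨c, d, hcd, hfac⟩ := Finset.card_eq_two.mp hfac
  have exists_cycleOf {c : Perm X} (hc : c ∈ σ.cycleFactorsFinset) : ∃ a, σ.cycleOf a = c := by
    obtain ⟨a, ha⟩ := (mem_cycleFactorsFinset_iff.mp hc).1.nonempty_support
    exact ⟨a, (cycle_is_cycleOf ha hc).symm⟩
  obtain ⟨a, rfl⟩ := exists_cycleOf (c := c) (by simp [hfac])
  obtain ⟨b, rfl⟩ := exists_cycleOf (c := d) (by simp [hfac])
  refine ⟨a, b, fun h => hcd h.cycleOf_eq, fun x => ?_, fun x => mem_support.mp (hmem x)⟩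
  have hx := cycleOf_mem_cycleFactorsFinset_iff.mpr (hmem x)
  rw [hfac, Finset.mem_insert, Finset.mem_singleton] at hx
  exact hx.imp (fun h => (sameCycle_iff_cycleOf_eq_of_mem_support (hmem a) (hmem x)).mpr h.symm)
    fun h => (sameCycle_iff_cycleOf_eq_of_mem_support (hmem b) (hmem x)).mpr h.symm


/-- For every `α ≥ 2` there are permutations `σ₁, σ₂` of `2α` points, each a
product of two disjoint `α`-cycles (so of order `α`), generating a transitive subgroup,
whose product `σ₁σ₂` is a product of exactly two disjoint transpositions, hence has
order `2` and exactly `2α − 4` fixed points. -/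
theorem exists_permutations_for_lemma41
    (α : ℕ) (hα : 2 ≤ α) :
    ∃ σ₁ σ₂ : Equiv.Perm (Fin (2 * α)),
      σ₁.cycleType = {α, α} ∧ σ₂.cycleType = {α, α} ∧
      orderOf σ₁ = α ∧ orderOf σ₂ = α ∧
      (∀ x y : Fin (2 * α),
        ∃ g ∈ Subgroup.closure ({σ₁, σ₂} : Set (Equiv.Perm (Fin (2 * α)))), g x = y) ∧
      (σ₁ * σ₂).cycleType = {2, 2} ∧
      orderOf (σ₁ * σ₂) = 2 ∧
      (Finset.univ.filter fun x => (σ₁ * σ₂) x = x).card = 2 * α - 4 := by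
  obtain ⟨σ, hσ⟩ : ∃ σ : Perm (Fin (2 * α)), σ.cycleType = {α, α} := by
    rw [exists_with_cycleType_iff]
    simp [hα, two_mul]
  obtain ⟨a, b, hab, horb, hfix⟩ := exists_two_orbits (σ := σ) (by simp [hσ])
    (by simp [hσ, two_mul])
  have hne : a ≠ b := fun h => hab (h ▸ SameCycle.refl σ a)
  have hσab : σ a ≠ b := fun h => hab (h ▸ sameCycle_apply_right.mpr (SameCycle.refl σ a))
  have hσba : σ b ≠ a := fun h => hab (h ▸ sameCycle_apply_left.mpr (SameCycle.refl σ b))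
  have hprod : σ * (swap a b * σ⁻¹ * (swap a b)⁻¹) = swap (σ a) (σ b) * swap a b := by
    rw [swap_apply_apply, swap_inv]
    simp only [mul_assoc]
  have hdisj : Disjoint (swap (σ a) (σ b)) (swap a b) := by
    rw [disjoint_iff_disjoint_support, support_swap hne, support_swap (σ.injective.ne hne)]
    simp [(hfix _).symm, hσab.symm, hσba.symm]
  have hprodType : (σ * (swap a b * σ⁻¹ * (swap a b)⁻¹)).cycleType = {2, 2} := by
    rw [hprod, hdisj.cycleType_mul, (isCycle_swap hne).cycleType,
      (isCycle_swap (σ.injective.ne hne)).cycleType, card_support_swap hne,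
      card_support_swap (σ.injective.ne hne)]
    rfl
  have hconj : (swap a b * σ⁻¹ * (swap a b)⁻¹).cycleType = {α, α} := by
    rw [cycleType_conj, cycleType_inv, hσ]
  have orderOf_eq {τ : Perm (Fin (2 * α))} {n : ℕ} (h : τ.cycleType = {n, n}) :
      orderOf τ = n := by
    rw [← lcm_cycleType, h]
    simp [lcm_same]
  refine ⟨σ, swap a b * σ⁻¹ * (swap a b)⁻¹, hσ, hconj, orderOf_eq hσ, orderOf_eq hconj, ?_,
    hprodType, orderOf_eq hprodType, ?_⟩
  · set G := Subgroup.closure {σ, swap a b * σ⁻¹ * (swap a b)⁻¹}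
    have hσG : σ ∈ G := Subgroup.subset_closure (by simp)
    have hprodG := G.mul_mem hσG
      (Subgroup.subset_closure (by simp) : swap a b * σ⁻¹ * (swap a b)⁻¹ ∈ G)
    have reach (x : Fin (2 * α)) : ∃ g ∈ G, g a = x := by
      rcases horb x with ⟨k, hk⟩ | ⟨k, hk⟩
      · exact ⟨σ ^ k, G.zpow_mem hσG k, hk⟩
      · refine ⟨_, G.mul_mem (G.zpow_mem hσG k) hprodG, ?_⟩
        rw [hprod, mul_apply, mul_apply, swap_apply_left,
          swap_apply_of_ne_of_ne hσab.symm (hfix b).symm, hk]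
    intro x y
    obtain ⟨g, hg, rfl⟩ := reach x
    obtain ⟨h, hh, rfl⟩ := reach y
    exact ⟨h * g⁻¹, G.mul_mem hh (G.inv_mem hg), by simp⟩
  · have hsupp := sum_cycleType (σ * (swap a b * σ⁻¹ * (swap a b)⁻¹))
    have hcard := Finset.card_compl (σ * (swap a b * σ⁻¹ * (swap a b)⁻¹)).support
    rw [← hsupp, hprodType, Fintype.card_fin] at hcard
    have hcompl : (Finset.univ.filter fun x => (σ * (swap a b * σ⁻¹ * (swap a b)⁻¹)) x = x) =
        (σ * (swap a b * σ⁻¹ * (swap a b)⁻¹)).supportᶜ := by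
      ext x
      rw [Finset.mem_filter_univ, Finset.mem_compl, notMem_support]
    rw [hcompl, hcard]
    rfl
end
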